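/- arXiv:1510.08093 — 3 statements merged into one kernel-verified Lean document; each statement's English description precedes it below -/
import Mathlib

section
/- Let ε > 0, let I ⊆ ℝ be an open interval, let η : ℝ² → ℝ be a C² function with η > 0 everywhere, and let w : ℝ² × I → ℂ be a C³ function satisfying the weighted Gross–Pitaevskii equation i η² ∂ₜw = div(η² ∇w) + (η⁴/ε²)(1 − |w|²)w pointwise on ℝ² × I. Then at every point of ℝ² × I, ∂ₜ J(w) = curl(F − G), where F is the vector field with components F_ℓ = (1/η²) Σ_{k=1,2} ∂_k( η² Re(∂_ℓ w · conj(∂_k w)) ), ℓ = 1,2, and G is the vector field with components G_ℓ = η² ∂_ℓ( (1 − |w|²)²/(4ε²) ), ℓ = 1,2; all spatial derivatives act in the ℝ² variable. -/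
open MeasureTheory Real

/-- Partial derivative in the `k`-th coordinate direction of `ℝ²`. -/
noncomputable def pd {E : Type*} [NormedAddCommGroup E] [NormedSpace ℝ E] (k : Fin 2)
    (f : EuclideanSpace ℝ (Fin 2) → E) (x : EuclideanSpace ℝ (Fin 2)) : E :=
  fderiv ℝ f x (EuclideanSpace.single k 1)

/-- Jacobian `J(w) = Im(conj(∂₁w) ∂₂w)`. -/
noncomputable def jac (w : EuclideanSpace ℝ (Fin 2) → ℂ)
    (x : EuclideanSpace ℝ (Fin 2)) : ℝ :=
  ((starRingEnd ℂ) (pd 0 w x) * pd 1 w x).im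

section PartialDerivatives

variable {V : Type*} [NormedAddCommGroup V] [NormedSpace ℝ V]

lemma pd_add (k : Fin 2) {f g : EuclideanSpace ℝ (Fin 2) → V} {x : EuclideanSpace ℝ (Fin 2)}
    (hf : DifferentiableAt ℝ f x) (hg : DifferentiableAt ℝ g x) :
    pd k (fun y => f y + g y) x = pd k f x + pd k g x := by
  simp [pd, fderiv_fun_add hf hg]

lemma pd_mul {A : Type*} [NormedCommRing A] [NormedAlgebra ℝ A] (k : Fin 2)
    {f g : EuclideanSpace ℝ (Fin 2) → A} {x : EuclideanSpace ℝ (Fin 2)}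
    (hf : DifferentiableAt ℝ f x) (hg : DifferentiableAt ℝ g x) :
    pd k (fun y => f y * g y) x = pd k f x * g x + f x * pd k g x := by
  simp [pd, fderiv_fun_mul hf hg, mul_comm, add_comm]

lemma pd_clm_comp {W : Type*} [NormedAddCommGroup W] [NormedSpace ℝ W] (L : V →L[ℝ] W)
    (k : Fin 2) {f : EuclideanSpace ℝ (Fin 2) → V} {x : EuclideanSpace ℝ (Fin 2)}
    (hf : DifferentiableAt ℝ f x) :
    pd k (fun y => L (f y)) x = L (pd k f x) := by
  have h := (L.hasFDerivAt.comp x hf.hasFDerivAt).fderiv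
  simp only [pd]
  rw [show (fun y => L (f y)) = L ∘ f from rfl, h]
  rfl

lemma pd_re_mul_conj (k : Fin 2) {f g : EuclideanSpace ℝ (Fin 2) → ℂ}
    {x : EuclideanSpace ℝ (Fin 2)}
    (hf : DifferentiableAt ℝ f x) (hg : DifferentiableAt ℝ g x) :
    pd k (fun y => (f y * (starRingEnd ℂ) (g y)).re) x
      = (pd k f x * (starRingEnd ℂ) (g x)).re + (f x * (starRingEnd ℂ) (pd k g x)).re := by
  have hg' : DifferentiableAt ℝ (fun y => (starRingEnd ℂ) (g y)) x :=
    Complex.conjCLE.differentiableAt.comp x hg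
  have h1 := pd_clm_comp Complex.reCLM k (hf.mul hg')
  have h2 := pd_clm_comp (Complex.conjCLE : ℂ →L[ℝ] ℂ) k hg
  have h3 := pd_mul k hf hg'
  simp only [ContinuousLinearEquiv.coe_coe, Complex.conjCLE_apply] at h2
  rw [h2] at h3
  simp only [Complex.reCLM_apply, Pi.mul_apply] at h1
  rw [← Complex.add_re, ← h3]
  exact h1

lemma contDiff_re_mul_conj {n : WithTop ℕ∞} {f g : EuclideanSpace ℝ (Fin 2) → ℂ}
    (hf : ContDiff ℝ n f) (hg : ContDiff ℝ n g) :
    ContDiff ℝ n (fun y => (f y * (starRingEnd ℂ) (g y)).re) :=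
  Complex.reCLM.contDiff.comp (hf.mul (Complex.conjCLE.contDiff.comp hg))

lemma ContDiff.pd {n m : WithTop ℕ∞} (k : Fin 2) {f : EuclideanSpace ℝ (Fin 2) → V}
    (hf : ContDiff ℝ n f) (hmn : m + 1 ≤ n) : ContDiff ℝ m (_root_.pd k f) :=
  (hf.fderiv_right hmn).clm_apply contDiff_const

lemma pd_comm (k l : Fin 2) {f : EuclideanSpace ℝ (Fin 2) → V} (hf : ContDiff ℝ 2 f)
    (x : EuclideanSpace ℝ (Fin 2)) : pd k (pd l f) x = pd l (pd k f) x := by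
  have hd : DifferentiableAt ℝ (fderiv ℝ f) x :=
    ((hf.fderiv_right (m := 1) (by norm_num)).differentiable (by norm_num)) x
  have key (i j : Fin 2) : pd i (pd j f) x
      = fderiv ℝ (fderiv ℝ f) x (EuclideanSpace.single i 1) (EuclideanSpace.single j 1) := by
    have h := (hd.hasFDerivAt.clm_apply
      (hasFDerivAt_const (EuclideanSpace.single j (1 : ℝ)) x)).fderiv
    change fderiv ℝ (fun y => fderiv ℝ f y (EuclideanSpace.single j (1 : ℝ))) x _ = _
    rw [h]
    simp
  rw [key, key]
  exact (hf.contDiffAt.isSymmSndFDerivAt (by simp)).eq _ _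

end PartialDerivatives

section TimeSlices

variable {V : Type*} [NormedAddCommGroup V] [NormedSpace ℝ V]
  {I : Set ℝ} {w : EuclideanSpace ℝ (Fin 2) × ℝ → V}

lemma contDiffAt_of_mem_strip {n : WithTop ℕ∞} (hI : IsOpen I)
    (hw : ContDiffOn ℝ n w (Set.univ ×ˢ I)) (x : EuclideanSpace ℝ (Fin 2)) {t : ℝ}
    (ht : t ∈ I) : ContDiffAt ℝ n w (x, t) :=
  hw.contDiffAt ((isOpen_univ.prod hI).mem_nhds ⟨Set.mem_univ _, ht⟩)

lemma contDiff_slice {n : WithTop ℕ∞} (hI : IsOpen I)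
    (hw : ContDiffOn ℝ n w (Set.univ ×ˢ I)) {t : ℝ} (ht : t ∈ I) :
    ContDiff ℝ n (fun y => w (y, t)) :=
  contDiff_iff_contDiffAt.2 fun x =>
    (contDiffAt_of_mem_strip hI hw x ht).comp x (contDiff_prodMk_left t).contDiffAt

lemma deriv_time_eq {x : EuclideanSpace ℝ (Fin 2)} {t : ℝ}
    (hw : DifferentiableAt ℝ w (x, t)) :
    deriv (fun s => w (x, s)) t = fderiv ℝ w (x, t) (0, 1) := by
  have h : HasDerivAt (fun s : ℝ => (x, s)) ((0 : EuclideanSpace ℝ (Fin 2)), (1 : ℝ)) t :=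
    (hasDerivAt_const t x).prodMk (hasDerivAt_id t)
  exact (hw.hasFDerivAt.comp_hasDerivAt t h).deriv

lemma pd_slice_eq (k : Fin 2) {x : EuclideanSpace ℝ (Fin 2)} {t : ℝ}
    (hw : DifferentiableAt ℝ w (x, t)) :
    pd k (fun y => w (y, t)) x = fderiv ℝ w (x, t) (EuclideanSpace.single k 1, 0) := by
  have h := (HasFDerivAt.comp (f := fun y => (y, t)) x hw.hasFDerivAt
    (hasFDerivAt_prodMk_left x t)).fderiv
  simp only [pd]
  rw [show (fun y => w (y, t)) = w ∘ (fun y => (y, t)) from rfl, h]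
  simp

lemma contDiff_deriv_time {n m : WithTop ℕ∞} (hI : IsOpen I)
    (hw : ContDiffOn ℝ n w (Set.univ ×ˢ I)) (hmn : m + 1 ≤ n) {t : ℝ} (ht : t ∈ I) :
    ContDiff ℝ m (fun y => deriv (fun s => w (y, s)) t) := by
  have h1 : n ≠ 0 := by rintro rfl; simp at hmn
  have h (y) := deriv_time_eq ((contDiffAt_of_mem_strip hI hw y ht).differentiableAt h1)
  simp only [h]
  refine ContDiff.clm_apply (contDiff_iff_contDiffAt.2 fun x => ?_) contDiff_const
  exact ((contDiffAt_of_mem_strip hI hw x ht).fderiv_right hmn).comp x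
    (contDiff_prodMk_left t).contDiffAt

lemma hasDerivAt_pd_slice (hI : IsOpen I) (hw : ContDiffOn ℝ 2 w (Set.univ ×ˢ I)) (k : Fin 2)
    (x : EuclideanSpace ℝ (Fin 2)) {t : ℝ} (ht : t ∈ I) :
    HasDerivAt (fun s => pd k (fun y => w (y, s)) x)
      (pd k (fun y => deriv (fun s => w (y, s)) t) x) t := by
  have hc := contDiffAt_of_mem_strip hI hw x ht
  have hd (y) {s} (hs : s ∈ I) : DifferentiableAt ℝ w (y, s) :=
    (contDiffAt_of_mem_strip hI hw y hs).differentiableAt (by norm_num)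
  have hdd : HasFDerivAt (fderiv ℝ w) (fderiv ℝ (fderiv ℝ w) (x, t)) (x, t) :=
    ((hc.fderiv_right (m := 1) (by norm_num)).differentiableAt (by norm_num)).hasFDerivAt
  have hsymm := (hc.isSymmSndFDerivAt (by simp)).eq
    ((0 : EuclideanSpace ℝ (Fin 2)), (1 : ℝ)) (EuclideanSpace.single k 1, 0)
  have hpd : pd k (fun y => deriv (fun s => w (y, s)) t) x
      = fderiv ℝ (fderiv ℝ w) (x, t) (EuclideanSpace.single k 1, 0) (0, 1) := by
    have h := ((HasFDerivAt.comp (f := fun y => (y, t)) x hdd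
      (hasFDerivAt_prodMk_left x t)).clm_apply
      (hasFDerivAt_const ((0 : EuclideanSpace ℝ (Fin 2)), (1 : ℝ)) x)).fderiv
    simp only [fun y => deriv_time_eq (hd y ht), pd]
    simp only [Function.comp_apply] at h
    rw [h]
    simp
  have hline : HasDerivAt (fun s : ℝ => (x, s)) ((0 : EuclideanSpace ℝ (Fin 2)), (1 : ℝ)) t :=
    (hasDerivAt_const t x).prodMk (hasDerivAt_id t)
  have hder := (hdd.comp_hasDerivAt t hline).clm_apply
    (hasDerivAt_const t ((EuclideanSpace.single k (1 : ℝ)), (0 : ℝ)))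
  rw [hpd, ← hsymm]
  refine HasDerivAt.congr_of_eventuallyEq (by simpa using hder) ?_
  filter_upwards [hI.mem_nhds ht] with s hs
  exact pd_slice_eq k (hd x hs)

end TimeSlices

/-- `∂ₜ J(w) = curl ⟨i ∂ₜw, ∇w⟩`. -/
lemma deriv_jac_eq_curl {I : Set ℝ} {w : EuclideanSpace ℝ (Fin 2) × ℝ → ℂ} (hI : IsOpen I)
    (hw : ContDiffOn ℝ 2 w (Set.univ ×ˢ I)) (x : EuclideanSpace ℝ (Fin 2)) {t : ℝ}
    (ht : t ∈ I) :
    deriv (fun s => jac (fun y => w (y, s)) x) t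
      = pd 0 (fun y => (Complex.I * deriv (fun s => w (y, s)) t *
          (starRingEnd ℂ) (pd 1 (fun z => w (z, t)) y)).re) x
        - pd 1 (fun y => (Complex.I * deriv (fun s => w (y, s)) t *
          (starRingEnd ℂ) (pd 0 (fun z => w (z, t)) y)).re) x := by
  have hu := contDiff_slice hI hw ht
  have hv := (contDiff_deriv_time (m := 1) hI hw (by norm_num) ht).differentiable (by norm_num) x
  have h0 := hasDerivAt_pd_slice hI hw 0 x ht
  have h1 := hasDerivAt_pd_slice hI hw 1 x ht
  have hp (k : Fin 2) : DifferentiableAt ℝ (pd k (fun z => w (z, t))) x :=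
    (hu.pd (m := 1) k (by norm_num)).differentiable (by norm_num) x
  have hIv := hv.const_mul Complex.I
  have hJ := (Complex.imCLM.hasFDerivAt.comp_hasDerivAt t
    (((Complex.conjCLE : ℂ →L[ℝ] ℂ).hasFDerivAt.comp_hasDerivAt t h0).mul h1)).deriv
  have hIpd (k : Fin 2) : pd k (fun y => Complex.I * deriv (fun s => w (y, s)) t) x
      = Complex.I * pd k (fun y => deriv (fun s => w (y, s)) t) x :=
    pd_clm_comp (ContinuousLinearMap.mul ℝ ℂ Complex.I) k hv
  rw [pd_re_mul_conj 0 hIv (hp 1), pd_re_mul_conj 1 hIv (hp 0), pd_comm 0 1 hu x, hIpd, hIpd]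
  refine hJ.trans ?_
  simp
  ring

/-- Pairing the weighted Gross–Pitaevskii equation with `∂_ℓ w`. -/
lemma stress_sub_potential_eq {ε : ℝ} (hε : 0 < ε) {η : EuclideanSpace ℝ (Fin 2) → ℝ}
    (hη : ContDiff ℝ 1 η) (hηpos : ∀ x, 0 < η x) {u v : EuclideanSpace ℝ (Fin 2) → ℂ}
    (hu : ContDiff ℝ 2 u)
    (hGP : ∀ x, Complex.I * ((η x : ℂ))^2 * v x
        = (∑ k : Fin 2, pd k (fun y => ((η y : ℂ))^2 * pd k u y) x)
          + ((η x : ℂ))^4 / (ε : ℂ)^2 * ((1 : ℂ) - ((‖u x‖ : ℝ) : ℂ)^2) * u x)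
    (l : Fin 2) (y : EuclideanSpace ℝ (Fin 2)) :
    (1 / (η y)^2) * ∑ k : Fin 2, pd k
        (fun z => (η z)^2 * (pd l u z * (starRingEnd ℂ) (pd k u z)).re) y
      - (η y)^2 * pd l (fun z => (1 - ‖u z‖^2)^2 / (4 * ε^2)) y
      = (Complex.I * v y * (starRingEnd ℂ) (pd l u y)).re
        + pd l (fun z => ∑ k : Fin 2, (pd k u z * (starRingEnd ℂ) (pd k u z)).re / 2) y := by
  have hud : DifferentiableAt ℝ u y := hu.differentiable (by norm_num) y
  have hp (k : Fin 2) : DifferentiableAt ℝ (pd k u) y :=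
    (hu.pd (m := 1) k (by norm_num)).differentiable (by norm_num) y
  have hs : DifferentiableAt ℝ (fun z => (η z)^2) y :=
    (hη.pow 2).differentiable (by norm_num) y
  have hN (f g : EuclideanSpace ℝ (Fin 2) → ℂ) (hf : DifferentiableAt ℝ f y)
      (hg : DifferentiableAt ℝ g y) :
      DifferentiableAt ℝ (fun z => (f z * (starRingEnd ℂ) (g z)).re) y :=
    Complex.reCLM.differentiableAt.comp y
      (hf.mul (Complex.conjCLE.differentiableAt.comp y hg))
  have hsc : DifferentiableAt ℝ (fun z => ((η z : ℂ))^2) y := by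
    simpa [Function.comp_def] using Complex.ofRealCLM.differentiableAt.comp y hs
  have hF (k : Fin 2) := pd_mul k hs (hN _ _ (hp l) (hp k))
  have hQ : pd l (fun z => ∑ k : Fin 2, (pd k u z * (starRingEnd ℂ) (pd k u z)).re / 2) y
      = ∑ k : Fin 2, (pd l (pd k u) y * (starRingEnd ℂ) (pd k u y)).re := by
    have h (k : Fin 2) := pd_clm_comp ((2 : ℝ)⁻¹ • ContinuousLinearMap.id ℝ ℝ) l
      (hN _ _ (hp k) (hp k))
    simp only [pd_re_mul_conj l (hp _) (hp _)] at h
    simp only [Fin.sum_univ_two, div_eq_mul_inv]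
    rw [pd_add l ((hN _ _ (hp 0) (hp 0)).mul_const (2 : ℝ)⁻¹)
      ((hN _ _ (hp 1) (hp 1)).mul_const (2 : ℝ)⁻¹)]
    simp only [smul_apply, ContinuousLinearMap.id_apply, smul_eq_mul,
      mul_comm (2 : ℝ)⁻¹] at h
    rw [h, h]
    simp only [Complex.mul_re, Complex.conj_re, Complex.conj_im]
    ring
  have hG : pd l (fun z => (1 - ‖u z‖^2)^2 / (4 * ε^2)) y
      = -(1 - ‖u y‖^2) * (pd l u y * (starRingEnd ℂ) (u y)).re / ε^2 := by
    have hnorm (z) : ‖u z‖^2 = (u z * (starRingEnd ℂ) (u z)).re := by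
      rw [Complex.mul_conj, Complex.ofReal_re, Complex.normSq_eq_norm_sq]
    simp only [hnorm]
    have hd := hN _ _ hud hud
    have hder := (((hd.hasFDerivAt.const_sub 1).pow 2).mul_const ((4 * ε^2)⁻¹)).fderiv
    have hnn := pd_re_mul_conj l hud hud
    simp only [pd] at hnn ⊢
    simp only [← div_eq_mul_inv] at hder
    rw [hder]
    simp only [smul_apply, neg_apply, hnn]
    simp only [smul_eq_mul, nsmul_eq_mul, Complex.mul_re, Complex.conj_re, Complex.conj_im]
    field_simp
    ring
  have hlap (k : Fin 2) := pd_mul k hsc (hp k)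
  have hsp (k : Fin 2) : pd k (fun z => ((η z : ℂ))^2) y
      = ((pd k (fun z => (η z)^2) y : ℝ) : ℂ) := by
    simpa using pd_clm_comp Complex.ofRealCLM k hs
  have hGPy := hGP y
  have hηy := (hηpos y).ne'
  simp only [hlap, hsp, Fin.sum_univ_two] at hGPy
  have hcomm (k : Fin 2) := pd_comm k l hu y
  rw [hQ, hG]
  simp only [hF, pd_re_mul_conj _ (hp _) (hp _), hcomm, Fin.sum_univ_two]
  have hre := congrArg Complex.re hGPy
  have him := congrArg Complex.im hGPy
  norm_cast at hre him
  simp [-Complex.ofReal_pow, -Complex.ofReal_mul] at hre him ⊢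
  field_simp at hre him ⊢
  linear_combination -(pd l u y).re * hre - (pd l u y).im * him

/-- evolution of the Jacobian for the weighted Gross–Pitaevskii equation:
`∂ₜ J(w) = curl (F − G)` with
`F_ℓ = (1/η²) Σ_k ∂_k(η² Re(∂_ℓ w conj(∂_k w)))` and `G_ℓ = η² ∂_ℓ((1−|w|²)²/(4ε²))`. -/
theorem jacobian_evolution
    (ε : ℝ) (hε : 0 < ε) (I : Set ℝ) (hIopen : IsOpen I) (hIconn : I.OrdConnected)
    (η : EuclideanSpace ℝ (Fin 2) → ℝ) (hη : ContDiff ℝ 2 η) (hηpos : ∀ x, 0 < η x)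
    (w : EuclideanSpace ℝ (Fin 2) × ℝ → ℂ)
    (hw : ContDiffOn ℝ 3 w (Set.univ ×ˢ I))
    (hGP : ∀ x : EuclideanSpace ℝ (Fin 2), ∀ t ∈ I,
      Complex.I * ((η x : ℂ))^2 * deriv (fun s => w (x, s)) t
        = (∑ k : Fin 2, pd k (fun y => ((η y : ℂ))^2 * pd k (fun z => w (z, t)) y) x)
          + ((η x : ℂ))^4 / (ε : ℂ)^2 * ((1 : ℂ) - ((‖w (x, t)‖ : ℝ) : ℂ)^2) * w (x, t)) :
    ∀ x : EuclideanSpace ℝ (Fin 2), ∀ t ∈ I,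
      -- F : the vector field with components F_ℓ
      ∀ F G : Fin 2 → EuclideanSpace ℝ (Fin 2) → ℝ,
      (∀ ℓ y, F ℓ y = (1 / (η y)^2) *
          ∑ k : Fin 2, pd k
            (fun z => (η z)^2 *
              (pd ℓ (fun z' => w (z', t)) z *
                (starRingEnd ℂ) (pd k (fun z' => w (z', t)) z)).re) y) →
      (∀ ℓ y, G ℓ y = (η y)^2 *
          pd ℓ (fun z => (1 - ‖w (z, t)‖^2)^2 / (4 * ε^2)) y) →
      deriv (fun s => jac (fun y => w (y, s)) x) t
        = pd 0 (fun y => F 1 y - G 1 y) x - pd 1 (fun y => F 0 y - G 0 y) x := by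
  intro x t ht F G hF hG
  have hu := contDiff_slice hIopen hw ht
  have hv := contDiff_deriv_time (m := 2) hIopen hw (by norm_num) ht
  have hQ : ContDiff ℝ 2 (fun z => ∑ k : Fin 2, (pd k (fun z' => w (z', t)) z *
      (starRingEnd ℂ) (pd k (fun z' => w (z', t)) z)).re / 2) :=
    ContDiff.sum fun k _ => (contDiff_re_mul_conj (hu.pd k (by norm_num))
      (hu.pd k (by norm_num))).div_const 2
  have hFG (l : Fin 2) (y) := stress_sub_potential_eq hε (hη.of_le (by norm_num)) hηpos
    (hu.of_le (by norm_num)) (fun x => hGP x t ht) l y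
  have hd (l : Fin 2) : DifferentiableAt ℝ (fun y => (Complex.I * deriv (fun s => w (y, s)) t *
      (starRingEnd ℂ) (pd l (fun z => w (z, t)) y)).re) x :=
    (contDiff_re_mul_conj (contDiff_const.mul hv) (hu.pd (m := 2) l (by norm_num))).differentiable
      (by norm_num) x
  have hdQ (l : Fin 2) := (hQ.pd (m := 1) l (by norm_num)).differentiable (by norm_num) x
  simp only [hF, hG, hFG]
  rw [pd_add 0 (hd 1) (hdQ 1), pd_add 1 (hd 0) (hdQ 0), pd_comm 0 1 hQ x,
    deriv_jac_eq_curl hIopen (hw.of_le (by norm_num)) x ht]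
  ring
end

section
/- Let u, v : ℝ² → ℂ be differentiable functions whose partial derivatives are square integrable. Then ∫_{ℝ²} |J(u) − J(v)| dx ≤ (1/2) ‖∇(u − v)‖_{L²(ℝ²)} ‖∇(u + v)‖_{L²(ℝ²)}, where for a differentiable f : ℝ² → ℂ, ‖∇f‖_{L²}² = ∫_{ℝ²} (|∂₁f|² + |∂₂f|²) dx. -/
open MeasureTheory Real

/-- Cauchy–Schwarz for the square roots of nonnegative integrable functions. -/
theorem integral_sqrt_mul_sqrt_le {α : Type*} [MeasurableSpace α] {μ : Measure α} {F G : α → ℝ}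
    (hF : Integrable F μ) (hG : Integrable G μ) (hF0 : ∀ x, 0 ≤ F x) (hG0 : ∀ x, 0 ≤ G x) :
    Integrable (fun x => √(F x) * √(G x)) μ ∧
      ∫ x, √(F x) * √(G x) ∂μ ≤ √(∫ x, F x ∂μ) * √(∫ x, G x ∂μ) := by
  have memLp_sqrt {H : α → ℝ} (hH : Integrable H μ) (hH0 : ∀ x, 0 ≤ H x) :
      MemLp (fun x => √(H x)) 2 μ := by
    rw [memLp_two_iff_integrable_sq
      (Real.continuous_sqrt.comp_aestronglyMeasurable hH.aestronglyMeasurable)]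
    simpa only [Real.sq_sqrt (hH0 _)] using hH
  have hF2 := memLp_sqrt hF hF0
  have hG2 := memLp_sqrt hG hG0
  refine ⟨hF2.integrable_mul hG2, ?_⟩
  have h := integral_mul_le_Lp_mul_Lq_of_nonneg Real.HolderConjugate.two_two
    (.of_forall fun x => Real.sqrt_nonneg (F x)) (.of_forall fun x => Real.sqrt_nonneg (G x))
    (by simpa using hF2) (by simpa using hG2)
  simpa only [Real.rpow_two, Real.sq_sqrt (hF0 _), Real.sq_sqrt (hG0 _),
    ← Real.sqrt_eq_rpow] using h

theorem abs_im_conj_mul_sub_le (a b c d : ℂ) :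
    |((starRingEnd ℂ) a * b).im - ((starRingEnd ℂ) c * d).im| ≤
      1 / 2 * (√(‖a - c‖ ^ 2 + ‖b - d‖ ^ 2) * √(‖a + c‖ ^ 2 + ‖b + d‖ ^ 2)) := by
  have hpol : ((starRingEnd ℂ) a * b).im - ((starRingEnd ℂ) c * d).im =
      1 / 2 * (((starRingEnd ℂ) (a - c) * (b + d)).im +
        ((starRingEnd ℂ) (a + c) * (b - d)).im) := by
    simp
    ring
  have h1 : |((starRingEnd ℂ) (a - c) * (b + d)).im| ≤ ‖a - c‖ * ‖b + d‖ := by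
    simpa only [norm_mul, RCLike.norm_conj] using
      Complex.abs_im_le_norm ((starRingEnd ℂ) (a - c) * (b + d))
  have h2 : |((starRingEnd ℂ) (a + c) * (b - d)).im| ≤ ‖a + c‖ * ‖b - d‖ := by
    simpa only [norm_mul, RCLike.norm_conj] using
      Complex.abs_im_le_norm ((starRingEnd ℂ) (a + c) * (b - d))
  rw [hpol, abs_mul, abs_of_pos (by norm_num : (0 : ℝ) < 1 / 2), ← Real.sqrt_mul (by positivity)]
  gcongr
  refine (abs_add_le _ _).trans ((add_le_add h1 h2).trans (Real.le_sqrt_of_sq_le ?_))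
  linarith [sq_nonneg (‖a - c‖ * ‖a + c‖ - ‖b - d‖ * ‖b + d‖)]

theorem pd_sub {E : Type*} [NormedAddCommGroup E] [NormedSpace ℝ E]
    {u v : EuclideanSpace ℝ (Fin 2) → E} (hu : Differentiable ℝ u) (hv : Differentiable ℝ v)
    (k : Fin 2) (x : EuclideanSpace ℝ (Fin 2)) :
    pd k (fun y => u y - v y) x = pd k u x - pd k v x := by
  simp [pd, fderiv_fun_sub (hu x) (hv x)]

theorem pd_add_s7 {E : Type*} [NormedAddCommGroup E] [NormedSpace ℝ E]
    {u v : EuclideanSpace ℝ (Fin 2) → E} (hu : Differentiable ℝ u) (hv : Differentiable ℝ v)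
    (k : Fin 2) (x : EuclideanSpace ℝ (Fin 2)) :
    pd k (fun y => u y + v y) x = pd k u x + pd k v x := by
  simp [pd, fderiv_fun_add (hu x) (hv x)]

theorem memLp_two_pd {u : EuclideanSpace ℝ (Fin 2) → ℂ} {k : Fin 2}
    (hu : Integrable (fun x => ‖pd k u x‖ ^ 2)) : MemLp (pd k u) 2 :=
  (memLp_two_iff_integrable_sq_norm
    (measurable_fderiv_apply_const ℝ u _).aestronglyMeasurable).2 hu

/-- `∫ |J(u) − J(v)| ≤ (1/2) ‖∇(u−v)‖_{L²} ‖∇(u+v)‖_{L²}` for differentiable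
`u, v : ℝ² → ℂ` with square-integrable partial derivatives. -/
theorem jacobian_L1_difference_bound
    (u v : EuclideanSpace ℝ (Fin 2) → ℂ)
    (hu : Differentiable ℝ u) (hv : Differentiable ℝ v)
    (hu2 : ∀ k : Fin 2, Integrable (fun x => ‖pd k u x‖^2))
    (hv2 : ∀ k : Fin 2, Integrable (fun x => ‖pd k v x‖^2)) :
    ∫ x, |jac u x - jac v x|
      ≤ (1 / 2) *
          Real.sqrt (∫ x, ∑ k : Fin 2, ‖pd k (fun y => u y - v y) x‖^2) *
          Real.sqrt (∫ x, ∑ k : Fin 2, ‖pd k (fun y => u y + v y) x‖^2) := by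
  simp only [pd_sub hu hv, pd_add_s7 hu hv]
  have hF : Integrable (fun x => ∑ k : Fin 2, ‖pd k u x - pd k v x‖ ^ 2) :=
    integrable_finsetSum _ fun k _ =>
      ((memLp_two_pd (hu2 k)).sub (memLp_two_pd (hv2 k))).integrable_norm_pow two_ne_zero
  have hG : Integrable (fun x => ∑ k : Fin 2, ‖pd k u x + pd k v x‖ ^ 2) :=
    integrable_finsetSum _ fun k _ =>
      ((memLp_two_pd (hu2 k)).add (memLp_two_pd (hv2 k))).integrable_norm_pow two_ne_zero
  obtain ⟨hint, hle⟩ := integral_sqrt_mul_sqrt_le hF hG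
    (fun x => by positivity) (fun x => by positivity)
  rw [mul_assoc]
  refine (integral_mono_of_nonneg (.of_forall fun x => abs_nonneg _)
    (hint.const_mul (1 / 2)) (.of_forall fun x => ?_)).trans ?_
  · simpa only [Fin.sum_univ_two, jac] using
      abs_im_conj_mul_sub_le (pd 0 u x) (pd 1 u x) (pd 0 v x) (pd 1 v x)
  · rw [integral_const_mul]
    gcongr
end

section
/- Let w : ℝ² → ℂ be differentiable at a point x ∈ ℝ² with w(x) ≠ 0. Then the function |w| : ℝ² → ℝ is differentiable at x and |∇w(x)|² = |∇|w|(x)|² + |j(w)(x)|²/|w(x)|², where |∇w|² = |∂₁w|² + |∂₂w|², |∇|w||² is the squared Euclidean norm of the gradient of x ↦ |w(x)|, and |j(w)|² = j(w)₁² + j(w)₂². -/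
open MeasureTheory Real

/-- Supercurrent `j(w)_k = Im(conj w ∂_k w)`. -/
noncomputable def scur (w : EuclideanSpace ℝ (Fin 2) → ℂ) (k : Fin 2)
    (x : EuclideanSpace ℝ (Fin 2)) : ℝ :=
  ((starRingEnd ℂ) (w x) * pd k w x).im

/-- Where `w` is differentiable and nonzero, `|w| ∂ₖ|w| = Re(conj w ∂ₖw)`. -/
theorem norm_mul_pd_norm (w : EuclideanSpace ℝ (Fin 2) → ℂ) (x : EuclideanSpace ℝ (Fin 2))
    (hw : DifferentiableAt ℝ w x) (hwx : w x ≠ 0) (k : Fin 2) :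
    ‖w x‖ * pd k (fun y => ‖w y‖) x = ((starRingEnd ℂ) (w x) * pd k w x).re := by
  have hn : DifferentiableAt ℝ (fun y => ‖w y‖) x := hw.norm ℝ hwx
  have h := congrArg (fun L => L (EuclideanSpace.single k 1))
    (hw.hasFDerivAt.norm_sq.unique (hn.hasFDerivAt.pow 2))
  simp [Complex.inner] at h
  simp only [pd, Complex.mul_re, Complex.conj_re, Complex.conj_im]
  linarith

/-- The pointwise splitting in one coordinate direction. -/
theorem norm_pd_sq (w : EuclideanSpace ℝ (Fin 2) → ℂ) (x : EuclideanSpace ℝ (Fin 2))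
    (hw : DifferentiableAt ℝ w x) (hwx : w x ≠ 0) (k : Fin 2) :
    ‖pd k w x‖ ^ 2 = (pd k (fun y => ‖w y‖) x) ^ 2 + (scur w k x) ^ 2 / ‖w x‖ ^ 2 := by
  have hpos : ‖w x‖ ≠ 0 := norm_ne_zero_iff.mpr hwx
  have hsq : (‖w x‖ * ‖pd k w x‖) ^ 2
      = (‖w x‖ * pd k (fun y => ‖w y‖) x) ^ 2 + (scur w k x) ^ 2 := by
    rw [norm_mul_pd_norm w x hw hwx k, scur, ← Complex.norm_conj (w x), ← norm_mul,
      Complex.sq_norm, Complex.normSq_apply]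
    ring
  field_simp
  linarith

/-- at a point where `w` is differentiable and nonzero, `|w|` is
differentiable and `|∇w|² = |∇|w||² + |j(w)|²/|w|²`. -/
theorem gradient_splitting
    (w : EuclideanSpace ℝ (Fin 2) → ℂ) (x : EuclideanSpace ℝ (Fin 2))
    (hw : DifferentiableAt ℝ w x) (hwx : w x ≠ 0) :
    DifferentiableAt ℝ (fun y => ‖w y‖) x ∧
    ∑ k : Fin 2, ‖pd k w x‖^2
      = (∑ k : Fin 2, (pd k (fun y => ‖w y‖) x)^2)
        + (∑ k : Fin 2, (scur w k x)^2) / ‖w x‖^2 := by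
  refine ⟨hw.norm ℝ hwx, ?_⟩
  simp only [norm_pd_sq w x hw hwx, Finset.sum_add_distrib, Finset.sum_div]
end
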